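/- arXiv:2010.08114 — 3 statements merged into one kernel-verified Lean document; each statement's English description precedes it below -/
import Mathlib

section
/- Let V be a finite type of entities, N : V → Finset V an assignment of neighbor sets, d a natural number, and for each entity i a per-entity objective t i : (V → EuclideanSpace ℝ (Fin d)) → ℝ that is local to the neighborhood of i, i.e. t i θ = t i θ' whenever θ j = θ' j for all j ∈ N i. Set T(θ) = Σ_{i ∈ V} t i θ and T_x(θ) = Σ_{i ∈ V, x ∈ N i} t i θ. Then for every fixed assignment θ, every entity x, and every vector m ∈ EuclideanSpace ℝ (Fin d): m is a maximizer of the function e ↦ T(Function.update θ x e) if and only if m is a maximizer of the function e ↦ T_x(Function.update θ x e). In other words, optimizing the total first-term objective with respect to the original embedding of entity x is equivalent to optimizing the second-term objective for x, so ordinary mini-batch training of the first term automatically optimizes the second term (Lemma 1, automatic distillation). -/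
/-- Lemma 1 (automatic distillation): a vector `m` maximizes the total first-term
objective, as a function of the embedding of entity `x`, if and only if it maximizes
the second-term objective for `x`. -/
theorem decentRL_automatic_distillation
    {V : Type*} [Fintype V] [DecidableEq V] (N : V → Finset V) (d : ℕ)
    (t : V → (V → EuclideanSpace ℝ (Fin d)) → ℝ)
    (hloc : ∀ (i : V) (θ θ' : V → EuclideanSpace ℝ (Fin d)),
      (∀ j ∈ N i, θ j = θ' j) → t i θ = t i θ')
    (θ : V → EuclideanSpace ℝ (Fin d)) (x : V) (m : EuclideanSpace ℝ (Fin d)) :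
    (∀ e : EuclideanSpace ℝ (Fin d),
        (∑ i, t i (Function.update θ x e)) ≤ ∑ i, t i (Function.update θ x m)) ↔
      (∀ e : EuclideanSpace ℝ (Fin d),
        (∑ i ∈ Finset.univ.filter (fun i => x ∈ N i), t i (Function.update θ x e)) ≤
          ∑ i ∈ Finset.univ.filter (fun i => x ∈ N i), t i (Function.update θ x m)) := by
  have hsum (e : EuclideanSpace ℝ (Fin d)) :
      ∑ i, t i (Function.update θ x e) =
        ∑ i ∈ Finset.univ.filter (fun i => x ∈ N i), t i (Function.update θ x e) +
          ∑ i ∈ Finset.univ.filter (fun i => x ∉ N i), t i θ := by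
    rw [← Finset.sum_filter_add_sum_filter_not Finset.univ (fun i => x ∈ N i)]
    congr 1
    refine Finset.sum_congr rfl fun i hi => hloc i _ _ fun j hj => ?_
    refine Function.update_of_ne ?_ _ _
    rintro rfl
    exact (Finset.mem_filter.mp hi).2 hj
  simp only [hsum, add_le_add_iff_right]
end

section
/- Let G and E be finite nonempty types and p : G → E → ℝ a joint pmf with p g e > 0 for all g, e and Σ_{g,e} p g e = 1, with marginals pG g = Σ_e p g e and pE e = Σ_g p g e, and mutual information I(p) = Σ_{g,e} p g e · Real.log(p g e / (pG g · pE e)). Let N ≥ 1 be a natural number and f : G → E → ℝ any critic with f g e > 0 for all g, e. Define the InfoNCE objective with one positive sample and N − 1 i.i.d. negative samples from the marginal pE: Î_N(f) = Σ_{g ∈ G} Σ_{e₀ ∈ E} p g e₀ · Σ_{(e₁,…,e_{N−1}) ∈ E^{N−1}} (∏_{j=1}^{N−1} pE e_j) · Real.log( f g e₀ / Σ_{j=0}^{N−1} f g e_j ). Then Î_N(f) + Real.log N ≤ I(p). -/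
/-- The total mass of the product of `n` copies of a weight `q` of total mass `1`. -/
lemma sum_prod_eq_one {E : Type*} [Fintype E] (q : E → ℝ) (hq : ∑ e, q e = 1) (n : ℕ) :
    ∑ v : Fin n → E, ∏ j, q (v j) = 1 := by
  classical
  have h := Finset.prod_univ_sum (fun _ : Fin n => (Finset.univ : Finset E)) (fun _ e => q e)
  simpa [hq, Fintype.piFinset_univ] using h.symm

/-- The expected softmax weight of a coordinate of an i.i.d. tuple does not depend on the
coordinate. -/
lemma sum_prod_mul_div_sum_eq {E : Type*} [Fintype E] (q h : E → ℝ) {n : ℕ} (i k : Fin n) :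
    ∑ u : Fin n → E, (∏ j, q (u j)) * (h (u i) / ∑ j, h (u j)) =
      ∑ u : Fin n → E, (∏ j, q (u j)) * (h (u k) / ∑ j, h (u j)) := by
  refine Fintype.sum_equiv ((Equiv.swap i k).arrowCongr (Equiv.refl E)) _ _ fun u => ?_
  have hprod := Equiv.prod_comp (Equiv.swap i k) fun j => q (u j)
  have hsum := Equiv.sum_comp (Equiv.swap i k) fun j => h (u j)
  simp [hprod, hsum]

/-- The expected softmax weight of the first of `n + 1` i.i.d. candidates is `1 / (n + 1)`. -/
lemma succ_mul_sum_softmax_eq_one {E : Type*} [Fintype E] (q h : E → ℝ) (hq : ∑ e, q e = 1)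
    (hh : ∀ e, 0 < h e) (n : ℕ) :
    ((n : ℝ) + 1) * ∑ e, ∑ v : Fin n → E,
      (q e * ∏ j, q (v j)) * (h e / (h e + ∑ j, h (v j))) = 1 := by
  have hcons : ∑ e, ∑ v : Fin n → E,
      (q e * ∏ j, q (v j)) * (h e / (h e + ∑ j, h (v j))) =
      ∑ u : Fin (n + 1) → E, (∏ j, q (u j)) * (h (u 0) / ∑ j, h (u j)) := by
    rw [← Fintype.sum_prod_type']
    refine Fintype.sum_equiv (Fin.consEquiv fun _ => E) _ _ fun x => ?_
    simp [Fin.consEquiv, Fin.prod_univ_succ, Fin.sum_univ_succ]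
  have hall : ∑ i : Fin (n + 1), ∑ u : Fin (n + 1) → E,
      (∏ j, q (u j)) * (h (u i) / ∑ j, h (u j)) = 1 := by
    rw [Finset.sum_comm, ← sum_prod_eq_one q hq (n + 1)]
    refine Finset.sum_congr rfl fun u _ => ?_
    have hpos : 0 < ∑ j, h (u j) :=
      Finset.sum_pos (fun j _ => hh (u j)) Finset.univ_nonempty
    rw [← Finset.mul_sum, ← Finset.sum_div, div_self hpos.ne', mul_one]
  rw [Finset.sum_congr rfl fun i _ => sum_prod_mul_div_sum_eq q h i 0] at hall
  simpa [hcons] using hall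

/-- The InfoNCE bound: for any positive critic `f` and `N ≥ 1` candidates (one positive
sample drawn jointly, `N - 1` i.i.d. negatives from the marginal `pE`), the InfoNCE
objective plus `log N` lower-bounds the mutual information. -/
theorem infoNCE_lower_bounds_mutual_information
    {G E : Type*} [Fintype G] [Fintype E] [Nonempty G] [Nonempty E]
    (p : G → E → ℝ) (hp : ∀ g e, 0 < p g e) (hsum : ∑ g, ∑ e, p g e = 1)
    (pG : G → ℝ) (hpG : ∀ g, pG g = ∑ e, p g e)
    (pE : E → ℝ) (hpE : ∀ e, pE e = ∑ g, p g e)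
    (I : ℝ) (hI : I = ∑ g, ∑ e, p g e * Real.log (p g e / (pG g * pE e)))
    (N : ℕ) (hN : 1 ≤ N)
    (f : G → E → ℝ) (hf : ∀ g e, 0 < f g e) :
    (∑ g, ∑ e₀, p g e₀ *
        ∑ v : Fin (N - 1) → E, (∏ j, pE (v j)) *
          Real.log (f g e₀ / (f g e₀ + ∑ j, f g (v j)))) + Real.log N ≤ I := by
  obtain ⟨n, rfl⟩ : ∃ n, N = n + 1 := ⟨N - 1, by omega⟩
  change (∑ g, ∑ e₀, p g e₀ *
        ∑ v : Fin n → E, (∏ j, pE (v j)) *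
          Real.log (f g e₀ / (f g e₀ + ∑ j, f g (v j)))) + Real.log (n + 1 : ℕ) ≤ I
  have hpG_pos g : 0 < pG g := by
    rw [hpG]
    exact Finset.sum_pos (fun e _ => hp g e) Finset.univ_nonempty
  have hpE_pos e : 0 < pE e := by
    rw [hpE]
    exact Finset.sum_pos (fun g _ => hp g e) Finset.univ_nonempty
  have hG : ∑ g, pG g = 1 := by simpa [hpG] using hsum
  have hE : ∑ e, pE e = 1 := by
    simp only [hpE]
    rwa [Finset.sum_comm]
  have hmass := sum_prod_eq_one pE hE n
  have hpoint g e (v : Fin n → E) :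
      p g e * ((∏ j, pE (v j)) * Real.log (f g e / (f g e + ∑ j, f g (v j)))) ≤
        p g e * (∏ j, pE (v j)) *
            (Real.log (p g e / (pG g * pE e)) - Real.log ((n : ℝ) + 1) - 1) +
          pG g * (((n : ℝ) + 1) *
            ((pE e * ∏ j, pE (v j)) * (f g e / (f g e + ∑ j, f g (v j))))) := by
    have hpge := hp g e
    have hg := hpG_pos g
    have he := hpE_pos e
    have hprod : 0 < ∏ j, pE (v j) := Finset.prod_pos fun j _ => hpE_pos (v j)
    have hs : 0 < f g e / (f g e + ∑ j, f g (v j)) :=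
      div_pos (hf g e) (add_pos_of_pos_of_nonneg (hf g e)
        (Finset.sum_nonneg fun j _ => (hf g (v j)).le))
    generalize f g e / (f g e + ∑ j, f g (v j)) = s at hs ⊢
    generalize ∏ j, pE (v j) = w at hprod ⊢
    have hn : (0 : ℝ) < n + 1 := by positivity
    have hr : 0 < p g e / (pG g * pE e) := by positivity
    have hlog := Real.log_le_sub_one_of_pos
      (show 0 < ((n : ℝ) + 1) * s / (p g e / (pG g * pE e)) by positivity)
    rw [Real.log_div (by positivity) hr.ne', Real.log_mul hn.ne' hs.ne'] at hlog
    have hmul := mul_le_mul_of_nonneg_left hlog (mul_pos hpge hprod).le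
    have hcancel : p g e * w * (((n : ℝ) + 1) * s / (p g e / (pG g * pE e))) =
        pG g * (((n : ℝ) + 1) * ((pE e * w) * s)) := by
      field_simp
    linarith
  have hsoftmax g := succ_mul_sum_softmax_eq_one pE (f g) hE (hf g) n
  calc
    _ ≤ (∑ g, ∑ e, ∑ v : Fin n → E, (p g e * (∏ j, pE (v j)) *
            (Real.log (p g e / (pG g * pE e)) - Real.log ((n : ℝ) + 1) - 1) +
          pG g * (((n : ℝ) + 1) *
            ((pE e * ∏ j, pE (v j)) * (f g e / (f g e + ∑ j, f g (v j))))))) +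
          Real.log ((n : ℝ) + 1) := by
      push_cast
      simp only [Finset.mul_sum]
      gcongr with g _ e _ v _
      exact hpoint g e v
    _ = I := by
      simp only [Finset.sum_add_distrib, ← Finset.mul_sum, ← Finset.sum_mul, hmass, hsoftmax,
        mul_one, hG, hI, mul_sub, Finset.sum_sub_distrib, hsum]
      ring
end

section
/- Let G and E be finite nonempty types and p : G → E → ℝ a joint pmf with p g e > 0 for all g, e and Σ_{g,e} p g e = 1, with marginals pG g = Σ_e p g e and pE e = Σ_g p g e, and mutual information I(p) = Σ_{g,e} p g e · Real.log(p g e / (pG g · pE e)). Fix natural numbers D, O and N ≥ 1, arbitrary feature maps φ : G → EuclideanSpace ℝ (Fin D) and ψ : E → EuclideanSpace ℝ (Fin O), an arbitrary linear map W : EuclideanSpace ℝ (Fin O) → EuclideanSpace ℝ (Fin D), and an arbitrary scalar b ∈ ℝ. Define the exponential critic f g e = Real.exp(⟪φ g, W (ψ e)⟫ + b) and the InfoNCE objective Î_N(f) = Σ_{g ∈ G} Σ_{e₀ ∈ E} p g e₀ · Σ_{(e₁,…,e_{N−1}) ∈ E^{N−1}} (∏_{j=1}^{N−1} pE e_j)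 · Real.log( f g e₀ / Σ_{j=0}^{N−1} f g e_j ). Then Î_N(f) + Real.log N ≤ I(p); in particular, the bound holds at every parameter configuration (φ, ψ, W, b), including configurations in which only some parameters have been optimized, so the mutual information is still lower-bounded in auto-distiller (Lemma 2). -/
open scoped RealInnerProductSpace

/-- Exchangeability: under a product weight, each of the `n + 1` normalized scores carries the same
share of the total mass. -/
theorem card_mul_sum_prod_mul_div_sum_eq_pow {E : Type*} [Fintype E] (q h : E → ℝ)
    (hh : ∀ e, 0 < h e) (n : ℕ) :
    ((n : ℝ) + 1) * ∑ e₀, q e₀ * ∑ v : Fin n → E, (∏ j, q (v j)) *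
        (h e₀ / (h e₀ + ∑ j, h (v j))) = (∑ e, q e) ^ (n + 1) := by
  set A : Fin (n + 1) → ℝ := fun i =>
    ∑ u : Fin (n + 1) → E, (∏ j, q (u j)) * (h (u i) / ∑ j, h (u j)) with hA
  have hA_cons : ∑ e₀, q e₀ * ∑ v : Fin n → E, (∏ j, q (v j)) *
      (h e₀ / (h e₀ + ∑ j, h (v j))) = A 0 := by
    simp only [hA]
    rw [← (Fin.consEquiv fun _ : Fin (n + 1) => E).sum_comp, Fintype.sum_prod_type]
    simp [Fin.consEquiv, Fin.prod_univ_succ, Fin.sum_univ_succ, Finset.mul_sum, mul_assoc]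
  have hA_swap : ∀ i, A i = A 0 := fun i => by
    simp only [hA]
    rw [← ((Equiv.swap 0 i).arrowCongr (Equiv.refl E)).sum_comp]
    refine Finset.sum_congr rfl fun u _ => ?_
    have hprod : ∏ j, q (u (Equiv.swap 0 i j)) = ∏ j, q (u j) :=
      Equiv.prod_comp (Equiv.swap 0 i) fun j => q (u j)
    have hsum : ∑ j, h (u (Equiv.swap 0 i j)) = ∑ j, h (u j) :=
      Equiv.sum_comp (Equiv.swap 0 i) fun j => h (u j)
    simp [Equiv.arrowCongr, hprod, hsum]
  have hA_sum : ∑ i, A i = (∑ e, q e) ^ (n + 1) := by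
    simp only [hA]
    rw [Finset.sum_comm, Fintype.sum_pow]
    refine Finset.sum_congr rfl fun u _ => ?_
    have hpos : 0 < ∑ j, h (u j) :=
      Finset.sum_pos (fun j _ => hh _) Finset.univ_nonempty
    rw [← Finset.mul_sum, ← Finset.sum_div, div_self hpos.ne', mul_one]
  rw [hA_cons, ← hA_sum, Finset.sum_congr rfl fun i _ => hA_swap i]
  simp

/-- A weighted form of `log x ≤ x - 1`, applied to `x = c * y / r` with `r = a / m`. -/
theorem mul_log_add_log_sub_log_le {a m c y : ℝ} (ha : 0 < a) (hm : 0 < m) (hc : 0 < c)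
    (hy : 0 < y) :
    a * (Real.log y + Real.log c - Real.log (a / m)) ≤ m * c * y - a := by
  have hlog : Real.log y + Real.log c - Real.log (a / m) = Real.log (y * c / (a / m)) := by
    rw [Real.log_div (mul_pos hy hc).ne' (div_pos ha hm).ne', Real.log_mul hy.ne' hc.ne']
  have hle := Real.log_le_sub_one_of_pos (show 0 < y * c / (a / m) by positivity)
  calc a * (Real.log y + Real.log c - Real.log (a / m))
      ≤ a * (y * c / (a / m) - 1) := by rw [hlog]; gcongr
    _ = m * c * y - a := by field_simp

/-- Lemma 2 (lower-bound): for the exponential critic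
`f g e = exp(⟪φ g, W (ψ e)⟫ + b)` of auto-distiller, at every parameter
configuration `(φ, ψ, W, b)` the InfoNCE objective plus `log N` lower-bounds
the mutual information. -/
theorem autoDistiller_mutual_information_lower_bound
    {G E : Type*} [Fintype G] [Fintype E] [Nonempty G] [Nonempty E]
    (p : G → E → ℝ) (hp : ∀ g e, 0 < p g e) (hsum : ∑ g, ∑ e, p g e = 1)
    (pG : G → ℝ) (hpG : ∀ g, pG g = ∑ e, p g e)
    (pE : E → ℝ) (hpE : ∀ e, pE e = ∑ g, p g e)
    (I : ℝ) (hI : I = ∑ g, ∑ e, p g e * Real.log (p g e / (pG g * pE e)))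
    (D O N : ℕ) (hN : 1 ≤ N)
    (φ : G → EuclideanSpace ℝ (Fin D)) (ψ : E → EuclideanSpace ℝ (Fin O))
    (W : EuclideanSpace ℝ (Fin O) →ₗ[ℝ] EuclideanSpace ℝ (Fin D)) (b : ℝ)
    (f : G → E → ℝ) (hfdef : ∀ g e, f g e = Real.exp (⟪φ g, W (ψ e)⟫ + b)) :
    (∑ g, ∑ e₀, p g e₀ *
        ∑ v : Fin (N - 1) → E, (∏ j, pE (v j)) *
          Real.log (f g e₀ / (f g e₀ + ∑ j, f g (v j)))) + Real.log N ≤ I := by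
  have hf : ∀ g e, 0 < f g e := fun g e => by rw [hfdef]; exact Real.exp_pos _
  have hpG_pos : ∀ g, 0 < pG g := fun g => by
    rw [hpG]; exact Finset.sum_pos (fun e _ => hp g e) Finset.univ_nonempty
  have hpE_pos : ∀ e, 0 < pE e := fun e => by
    rw [hpE]; exact Finset.sum_pos (fun g _ => hp g e) Finset.univ_nonempty
  have hpE_sum : ∑ e, pE e = 1 := by
    simp only [hpE]; rw [Finset.sum_comm]; exact hsum
  obtain ⟨n, rfl⟩ : ∃ n, N = n + 1 := ⟨N - 1, by omega⟩
  have hw_sum : ∑ v : Fin n → E, ∏ j, pE (v j) = 1 := by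
    rw [← Fintype.sum_pow, hpE_sum, one_pow]
  set c : ℝ := ((n + 1 : ℕ) : ℝ) with hc
  have hc_pos : 0 < c := by rw [hc]; positivity
  have hpair : ∀ g e₀, p g e₀ * (∑ v : Fin n → E, (∏ j, pE (v j)) *
        Real.log (f g e₀ / (f g e₀ + ∑ j, f g (v j)))) + p g e₀ * Real.log c
        - p g e₀ * Real.log (p g e₀ / (pG g * pE e₀)) ≤
      pG g * (c * (pE e₀ * ∑ v : Fin n → E, (∏ j, pE (v j)) *
        (f g e₀ / (f g e₀ + ∑ j, f g (v j))))) - p g e₀ := fun g e₀ => by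
    have hle : ∑ v : Fin n → E, (∏ j, pE (v j)) * (p g e₀ *
          (Real.log (f g e₀ / (f g e₀ + ∑ j, f g (v j))) + Real.log c
            - Real.log (p g e₀ / (pG g * pE e₀)))) ≤
        ∑ v : Fin n → E, (∏ j, pE (v j)) * (pG g * pE e₀ * c *
          (f g e₀ / (f g e₀ + ∑ j, f g (v j))) - p g e₀) := by
      refine Finset.sum_le_sum fun v _ => mul_le_mul_of_nonneg_left ?_
        (Finset.prod_nonneg fun j _ => (hpE_pos _).le)
      exact mul_log_add_log_sub_log_le (hp g e₀) (mul_pos (hpG_pos g) (hpE_pos e₀)) hc_pos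
        (div_pos (hf g e₀)
          (add_pos_of_pos_of_nonneg (hf g e₀) (Finset.sum_nonneg fun j _ => (hf _ _).le)))
    have haffine : ∀ (x : (Fin n → E) → ℝ) (s t : ℝ),
        ∑ v : Fin n → E, (∏ j, pE (v j)) * (s * x v + t) =
          s * (∑ v : Fin n → E, (∏ j, pE (v j)) * x v) + t := fun x s t => by
      simp only [mul_add, Finset.sum_add_distrib, ← Finset.sum_mul, hw_sum, one_mul,
        Finset.mul_sum, mul_left_comm s]
    have hleft := haffine (fun v => Real.log (f g e₀ / (f g e₀ + ∑ j, f g (v j)))) (p g e₀)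
      (p g e₀ * Real.log c - p g e₀ * Real.log (p g e₀ / (pG g * pE e₀)))
    have hright := haffine (fun v => f g e₀ / (f g e₀ + ∑ j, f g (v j))) (pG g * pE e₀ * c)
      (-p g e₀)
    simp only [mul_add, sub_eq_add_neg, mul_neg] at hle hleft hright ⊢
    simp only [add_assoc] at hle hleft hright ⊢
    rw [hleft, hright] at hle
    convert hle using 2
    ring
  have hrow : ∀ g, (∑ e₀, p g e₀ * ∑ v : Fin n → E, (∏ j, pE (v j)) *
        Real.log (f g e₀ / (f g e₀ + ∑ j, f g (v j)))) + pG g * Real.log c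
        ≤ ∑ e₀, p g e₀ * Real.log (p g e₀ / (pG g * pE e₀)) := fun g => by
    have hle := Finset.sum_le_sum fun e₀ (_ : e₀ ∈ Finset.univ) => hpair g e₀
    have hexch := card_mul_sum_prod_mul_div_sum_eq_pow pE (f g) (hf g) n
    rw [hpE_sum, one_pow, ← Nat.cast_succ, Nat.succ_eq_add_one, ← hc] at hexch
    rw [Finset.sum_sub_distrib, Finset.sum_sub_distrib, Finset.sum_add_distrib,
      ← Finset.sum_mul, ← Finset.mul_sum, ← Finset.mul_sum, hexch, ← hpG] at hle
    linarith
  have htotal := Finset.sum_le_sum fun g (_ : g ∈ Finset.univ) => hrow g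
  have hpG_sum : ∑ g, pG g = 1 := by simp only [hpG]; exact hsum
  rw [Finset.sum_add_distrib, ← Finset.sum_mul, hpG_sum, one_mul, ← hI] at htotal
  exact htotal
end
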